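/- Theorem (counterexample: weak reversion yields underperformance in expectation). Fix n = 2, rebalancing times T = {0,1}, s > 0, F₁(0) = F₁(1) = 1, and Y₂(0) = Y₂(1) = 0. There exist A > 0 and a process Y₁ with P(Y₁(0) = s) = P(Y₁(0) = −s) = 1/2 and 1-step transition probabilities M(y₁,y₂) from time 0 to time 1 satisfying: (i) M(s, (1±1)s) = M(−s, −(1±1)s); (ii) M(s, 2s) < M(s, 0); (iii) M(s, 2s) + M(s, 0) = 1; such that, taking F₂(0) = F₂(1) = A, one has E[log(V_{π²}(1)/V_{π⁰}(1))] < E[log(V_{π²}(0)/V_{π⁰}(0))] = 0, i.e. the fundamental portfolio underperforms the market portfolio in expectation despite symmetric reversion toward the fundamental being more likely than not. -/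

import Mathlib

open MeasureTheory Real Set
open scoped ENNReal

noncomputable section

/-- The log relative value of the fundamental to the market portfolio, as a sum of logarithms. -/
lemma log_relative_value {A : ℝ} (hA : 0 < A) (y z : ℝ) :
    log (((1 / (1 + A)) * exp (z - y) + A / (1 + A)) /
      ((exp y / (exp y + A)) * exp (z - y) + A / (exp y + A))) =
    log (exp (z - y) + A) - log (1 + A) + log (exp y + A) - log (exp z + A) := by
  have hy := exp_pos y
  have hz := exp_pos z
  have hzy := exp_pos (z - y)
  have h1 : (1 / (1 + A)) * exp (z - y) + A / (1 + A) = (exp (z - y) + A) / (1 + A) := by ring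
  have h2 : (exp y / (exp y + A)) * exp (z - y) + A / (exp y + A) =
      (exp z + A) / (exp y + A) := by
    rw [show exp z = exp y * exp (z - y) by rw [← exp_add]; congr 1; ring]
    ring
  rw [h1, h2, log_div (by positivity) (by positivity), log_div (by positivity) (by positivity),
    log_div (by positivity) (by positivity)]
  ring

lemma log_one_add_lt_quarter {c u : ℝ} (hc : 0 < c) (hu : 0 < u) (h : u * (10 * (1 + c)) ≤ 1) :
    4 * log (1 + u * c) < log (1 + u * (c ^ 2 + 4 * c)) := by
  have huc : 0 < u * c := mul_pos hu hc
  have h4 : 4 * log (1 + u * c) = log ((1 + u * c) ^ 4) := by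
    rw [log_pow]; norm_num
  rw [h4]
  apply log_lt_log (by positivity)
  have h1 : u ≤ 1 / 10 := by nlinarith
  have h2 : u * c ≤ 1 / 10 := by nlinarith
  have key : 6 * u + 4 * u * (u * c) + u * (u * c) ^ 2 < 1 := by
    have : (u * c) ^ 2 ≤ 1 := by nlinarith
    nlinarith [mul_le_mul_of_nonneg_left h2 hu.le, mul_le_mul_of_nonneg_left this hu.le]
  nlinarith [mul_lt_mul_of_pos_left key (show 0 < u * c ^ 2 by positivity)]

lemma log_add_mul_log_add {A x w : ℝ} (hA : 0 < A) (hx : 0 < x) (hw : 0 < w) (hxw : x * w = 1) :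
    log (x + A) + log (w + A) - 2 * log (1 + A) =
      log (1 + A / (1 + A) ^ 2 * (x + w - 2)) := by
  have h : 1 + A / (1 + A) ^ 2 * (x + w - 2) = (x + A) * (w + A) / (1 + A) ^ 2 := by
    have : (x + A) * (w + A) = (1 + A) ^ 2 + A * (x + w - 2) := by linear_combination hxw
    rw [this]
    field_simp
  rw [h, log_div (by positivity) (by positivity), log_mul (by positivity) (by positivity), log_pow]
  norm_num

lemma exists_negative_expected_log_relative_value {s : ℝ} (hs : 0 < s) :
    ∃ A p : ℝ, 0 < A ∧ 0 < p ∧ p < 1 / 2 ∧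
      ∀ g : ℝ → ℝ → ℝ, (∀ y z, g y z =
        log (exp (z - y) + A) - log (1 + A) + log (exp y + A) - log (exp z + A)) →
      2⁻¹ * (p * g s (2 * s) + (1 - p) * g s 0 +
        (p * g (-s) (2 * -s) + (1 - p) * g (-s) 0)) < 0 := by
  obtain ⟨x, hx⟩ : ∃ x, x = exp s := ⟨_, rfl⟩
  obtain ⟨w, hw⟩ : ∃ w, w = exp (-s) := ⟨_, rfl⟩
  have hx0 : 0 < x := hx ▸ exp_pos _
  have hw0 : 0 < w := hw ▸ exp_pos _
  have hxw : x * w = 1 := by rw [hx, hw, ← exp_add]; simp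
  have hx1 : 1 < x := by rw [hx]; exact one_lt_exp_iff.2 hs
  have hx2 : exp (2 * s) = x ^ 2 := by rw [hx, ← exp_nat_mul]; norm_num
  have hw2 : exp (2 * -s) = w ^ 2 := by rw [hw, ← exp_nat_mul]; norm_num
  obtain ⟨c, hc⟩ : ∃ c, c = x + w - 2 := ⟨_, rfl⟩
  have hc0 : 0 < c := by
    have : x * c = (x - 1) ^ 2 := by rw [hc]; linear_combination hxw
    have h : 0 < (x - 1) ^ 2 := by have := sub_pos.2 hx1; positivity
    rw [← this] at h
    exact pos_of_mul_pos_right h hx0.le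
  have hA : 0 < 1 / (10 * (1 + c)) := by positivity
  obtain ⟨A, hAc⟩ : ∃ A, A = 1 / (10 * (1 + c)) := ⟨_, rfl⟩
  rw [← hAc] at hA
  have hu : 0 < A / (1 + A) ^ 2 := by positivity
  have hu1 : A / (1 + A) ^ 2 * (10 * (1 + c)) ≤ 1 := by
    have h1 : A / (1 + A) ^ 2 ≤ A := div_le_self hA.le (by nlinarith)
    calc _ ≤ A * (10 * (1 + c)) := by gcongr
      _ = 1 := by rw [hAc]; field_simp
  have hlt := log_one_add_lt_quarter hc0 hu hu1
  have ha := log_add_mul_log_add hA hx0 hw0 hxw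
  have hb := log_add_mul_log_add hA (pow_pos hx0 2) (pow_pos hw0 2)
    (by rw [← mul_pow, hxw, one_pow])
  rw [← hc] at ha
  rw [show x ^ 2 + w ^ 2 - 2 = c ^ 2 + 4 * c by rw [hc]; linear_combination (-2) * hxw] at hb
  have ha0 : 0 < log (1 + A / (1 + A) ^ 2 * c) := log_pos (by have := mul_pos hu hc0; linarith)
  rw [← hb, ← ha] at hlt
  rw [← ha] at ha0
  obtain ⟨a, had⟩ : ∃ a, a = log (x + A) + log (w + A) - 2 * log (1 + A) := ⟨_, rfl⟩
  obtain ⟨b, hbd⟩ : ∃ b, b = log (x ^ 2 + A) + log (w ^ 2 + A) - 2 * log (1 + A) := ⟨_, rfl⟩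
  rw [← had, ← hbd] at hlt
  rw [← had] at ha0
  have hb0 : 0 < b := by linarith
  have hab : a / b < 1 / 4 := by rw [div_lt_iff₀ hb0]; linarith
  refine ⟨A, 1 / 4 + a / b, hA, by positivity, by linarith, fun g hg => ?_⟩
  simp only [hg, show 2 * s - s = s by ring, show 2 * -s - -s = -s by ring, zero_sub, neg_neg,
    exp_zero, hx2, hw2, ← hx, ← hw]
  have hdiv : a / b * b = a := div_mul_cancel₀ a hb0.ne'
  obtain ⟨r, hr⟩ : ∃ r, r = a / b := ⟨_, rfl⟩
  rw [← hr] at hdiv ⊢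
  have e : 2⁻¹ * ((1 / 4 + r) * (log (x + A) - log (1 + A) + log (x + A) - log (x ^ 2 + A)) +
      (1 - (1 / 4 + r)) * (log (w + A) - log (1 + A) + log (x + A) - log (1 + A)) +
      ((1 / 4 + r) * (log (w + A) - log (1 + A) + log (w + A) - log (w ^ 2 + A)) +
      (1 - (1 / 4 + r)) * (log (x + A) - log (1 + A) + log (w + A) - log (1 + A)))) =
      a - (1 / 4 + r) / 2 * b := by
    rw [had, hbd]; ring
  rw [e]
  nlinarith

/-- The law on `Bool × Bool` of a fair first coordinate and an independent second coordinate that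
is `true` with probability `p`. -/
def fairProdMeasure (p : ℝ) : Measure (Bool × Bool) :=
  (2⁻¹ : ℝ≥0∞) • (ENNReal.ofReal p • Measure.dirac (true, true) +
    ENNReal.ofReal (1 - p) • Measure.dirac (true, false) +
    (ENNReal.ofReal p • Measure.dirac (false, true) +
      ENNReal.ofReal (1 - p) • Measure.dirac (false, false)))

lemma ofReal_add_ofReal_one_sub {p : ℝ} (hp : 0 ≤ p) (hp1 : p ≤ 1) :
    ENNReal.ofReal p + ENNReal.ofReal (1 - p) = 1 := by
  rw [← ENNReal.ofReal_add hp (by linarith)]; simp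

lemma isProbabilityMeasure_fairProdMeasure {p : ℝ} (hp : 0 ≤ p) (hp1 : p ≤ 1) :
    IsProbabilityMeasure (fairProdMeasure p) := by
  constructor
  simp only [fairProdMeasure, Measure.smul_apply, Measure.add_apply, measure_univ, smul_eq_mul,
    mul_one, ofReal_add_ofReal_one_sub hp hp1]
  rw [one_add_one_eq_two, ENNReal.inv_mul_cancel (by simp) (by simp)]

lemma integral_fairProdMeasure {p : ℝ} (hp : 0 ≤ p) (hp1 : p ≤ 1) (f : Bool × Bool → ℝ) :
    ∫ ω, f ω ∂(fairProdMeasure p) =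
      2⁻¹ * (p * f (true, true) + (1 - p) * f (true, false) +
        (p * f (false, true) + (1 - p) * f (false, false))) := by
  have hi (a : Bool × Bool) (r : ℝ) : Integrable f (ENNReal.ofReal r • Measure.dirac a) :=
    (integrable_dirac (by simp)).smul_measure (by simp)
  rw [fairProdMeasure, integral_smul_measure,
    integral_add_measure ((hi _ _).add_measure (hi _ _)) ((hi _ _).add_measure (hi _ _)),
    integral_add_measure (hi _ _) (hi _ _), integral_add_measure (hi _ _) (hi _ _)]
  simp [integral_smul_measure, ENNReal.toReal_ofReal, hp, hp1]

/-- **Counterexample theorem.** Two stocks, times `0,1`, `F₁ ≡ 1`, `Y₂ ≡ 0` (so `X₂ ≡ F₂ ≡ A`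
and `X₁(t) = exp(Y₁(t))`). For every `s > 0` there exist `A > 0` and a process `Y₁` with
`P(Y₁(0) = s) = P(Y₁(0) = −s) = 1/2` and 1-step transition probabilities `M` satisfying
(i) `M(s,(1±1)s) = M(−s,−(1±1)s)`, (ii) `M(s,2s) < M(s,0)`, (iii) `M(s,2s) + M(s,0) = 1`,
such that, taking `F₂(0) = F₂(1) = A`, the fundamental portfolio `π²` underperforms the market
portfolio `π⁰` in expectation:
`E[log(V_{π²}(1)/V_{π⁰}(1))] < 0 = E[log(V_{π²}(0)/V_{π⁰}(0))]`.
Here `V_{π²}(1) = (1/(1+A))·X₁(1)/X₁(0) + A/(1+A)` and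
`V_{π⁰}(1) = (X₁(0)/(X₁(0)+A))·X₁(1)/X₁(0) + A/(X₁(0)+A)`, with `X₁(t) = exp(Y₁(t))`. -/
theorem fundamental_underperforms_market_counterexample (s : ℝ) (hs : 0 < s) :
    ∃ A : ℝ, 0 < A ∧
    ∃ (Ω : Type) (_ : MeasurableSpace Ω) (P : Measure Ω) (_ : IsProbabilityMeasure P)
      (Y₁ : Ω → ℕ → ℝ) (M : ℝ → ℝ → ℝ),
      (∀ k : ℕ, Measurable (fun ω => Y₁ ω k)) ∧
      -- `P(Y₁(0) = s) = P(Y₁(0) = −s) = 1/2`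
      P {ω | Y₁ ω 0 = s} = 1/2 ∧ P {ω | Y₁ ω 0 = -s} = 1/2 ∧
      -- `M` consists of the 1-step transition probabilities from time 0 to time 1
      (∀ y₁ y₂ : ℝ, 0 ≤ M y₁ y₂) ∧
      (∀ y₁ y₂ : ℝ, P {ω | Y₁ ω 0 = y₁ ∧ Y₁ ω 1 = y₂} =
        ENNReal.ofReal (M y₁ y₂) * P {ω | Y₁ ω 0 = y₁}) ∧
      -- (i): `M(s,(1±1)s) = M(−s,−(1±1)s)`
      M s ((1+1)*s) = M (-s) (-((1+1)*s)) ∧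
      M s ((1-1)*s) = M (-s) (-((1-1)*s)) ∧
      -- (ii): `M(s,2s) < M(s,0)`
      M s (2*s) < M s 0 ∧
      -- (iii): `M(s,2s) + M(s,0) = 1`
      M s (2*s) + M s 0 = 1 ∧
      -- the fundamental portfolio underperforms the market portfolio in expectation
      (∫ ω, Real.log
          (((1/(1+A)) * Real.exp (Y₁ ω 1 - Y₁ ω 0) + A/(1+A)) /
           ((Real.exp (Y₁ ω 0)/(Real.exp (Y₁ ω 0)+A)) * Real.exp (Y₁ ω 1 - Y₁ ω 0)
             + A/(Real.exp (Y₁ ω 0)+A))) ∂P) < 0 := by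
  obtain ⟨A, p, hA, hp, hp2, hneg⟩ := exists_negative_expected_log_relative_value hs
  have hp1 : p ≤ 1 := by linarith
  have hsum : (2⁻¹ : ℝ≥0∞) * ENNReal.ofReal p + 2⁻¹ * ENNReal.ofReal (1 - p) = 2⁻¹ := by
    rw [← mul_add, ofReal_add_ofReal_one_sub hp.le hp1, mul_one]
  have hss : s ≠ -s := by linarith
  have hss' : -s ≠ s := by linarith
  have hs0 : s ≠ 0 := hs.ne'
  refine ⟨A, hA, Bool × Bool, inferInstance, fairProdMeasure p,
    isProbabilityMeasure_fairProdMeasure hp.le hp1,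
    fun ω k => if k = 0 then (if ω.1 then s else -s) else
      (if ω.2 then 2 * (if ω.1 then s else -s) else 0),
    fun y z => if z = 2 * y then p else if z = 0 then 1 - p else 0,
    fun k => measurable_of_finite _, ?_, ?_, ?_, ?_, ?_, ?_, ?_, ?_, ?_⟩
  · simp [fairProdMeasure, Set.indicator, hss', hsum]
  · simp [fairProdMeasure, Set.indicator, hss, hsum]
  · intro y z
    dsimp only
    split_ifs <;> linarith
  · intro y z
    by_cases h1 : y = s
    · subst h1
      by_cases h2 : z = 2 * y
      · subst h2
        simp [fairProdMeasure, Set.indicator, hss', hsum, hs0, mul_comm _ (2⁻¹ : ℝ≥0∞)]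
      · by_cases h3 : z = 0
        · subst h3
          simp [fairProdMeasure, Set.indicator, hss', hsum, hs0, mul_comm _ (2⁻¹ : ℝ≥0∞)]
        · simp [fairProdMeasure, Set.indicator, hss', h2, h3, Ne.symm h2, Ne.symm h3]
    · by_cases h1' : y = -s
      · subst h1'
        by_cases h2 : z = 2 * -s
        · subst h2
          simp [fairProdMeasure, Set.indicator, hss, hsum, hs0, mul_comm _ (2⁻¹ : ℝ≥0∞)]
        · by_cases h3 : z = 0
          · subst h3
            simp [fairProdMeasure, Set.indicator, hss, hsum, hs0, mul_comm _ (2⁻¹ : ℝ≥0∞)]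
          · have h2' : ¬ -(2 * s) = z := fun h => h2 (by rw [← h]; ring)
            have h2'' : ¬ z = -(2 * s) := fun h => h2' h.symm
            simp [fairProdMeasure, Set.indicator, hss, h2', h2'', h3, Ne.symm h3]
      · simp [fairProdMeasure, Set.indicator, Ne.symm h1, Ne.symm h1']
  · simp [one_add_one_eq_two]
  · simp [hs0]
  · simp [hs0]
    linarith
  · simp [hs0]
  · rw [integral_fairProdMeasure hp.le hp1]
    simpa using hneg _ (log_relative_value hA)
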